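/- Every 2-cocycle of a semisimple finite-dimensional real Lie algebra with values in the trivial module ℝ is a coboundary; that is, if ω satisfies the cocycle identity, then there exists a linear functional λ: G → ℝ with ω(x,y) = λ([x,y]) for all x,y (Whitehead's second lemma in degree 2). -/

import Mathlib

/-- Whitehead's second lemma in degree 2: every 2-cocycle of a finite-dimensional
semisimple real Lie algebra with values in the trivial module `ℝ` is a coboundary,
i.e. of the form `(x, y) ↦ λ [x, y]` for a linear functional `λ`. -/
theorem whitehead_second_lemma {G : Type*} [LieRing G] [LieAlgebra ℝ G]
    [FiniteDimensional ℝ G] [LieAlgebra.IsSemisimple ℝ G]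
    (ω : G →ₗ[ℝ] G →ₗ[ℝ] ℝ)
    (halt : ∀ x : G, ω x x = 0)
    (hcoc : ∀ x y z : G, ω ⁅x, y⁆ z + ω ⁅y, z⁆ x + ω ⁅z, x⁆ y = 0) :
    ∃ l : G →ₗ[ℝ] ℝ, ∀ x y : G, ω x y = l ⁅x, y⁆ := by
  have hskew : ∀ x y, ω x y = - ω y x := by
    intro x y
    have h := halt (x + y)
    simp only [map_add, LinearMap.add_apply, halt] at h
    linarith
  have hK : LieAlgebra.IsKilling ℝ G := inferInstance
  have hnd : (killingForm ℝ G).Nondegenerate := LieAlgebra.IsKilling.killingForm_nondegenerate ℝ G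
  have hinv : ∀ x y z : G, killingForm ℝ G ⁅x, y⁆ z = killingForm ℝ G x ⁅y, z⁆ :=
    LieModule.traceForm_apply_lie_apply ℝ G G
  let e : G ≃ₗ[ℝ] Module.Dual ℝ G := LinearMap.BilinForm.toDual (killingForm ℝ G) hnd
  have he : ∀ x y, e x y = killingForm ℝ G x y := fun x y => rfl
  let D : G →ₗ[ℝ] G := e.symm.toLinearMap ∘ₗ ω
  have hD : ∀ x y, killingForm ℝ G (D x) y = ω x y := by
    intro x y
    rw [← he]
    simp [D]
  let D' : LieDerivation ℝ G G :=
    { D with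
      leibniz' := by
        intro a b
        change D ⁅a, b⁆ = ⁅a, D b⁆ - ⁅b, D a⁆
        apply e.injective
        ext z
        have h1 := hcoc a b z
        have h2 := hskew ⁅b, z⁆ a
        have h3 := hskew ⁅z, a⁆ b
        have h4 : ω b ⁅z, a⁆ = - ω b ⁅a, z⁆ := by rw [← lie_skew, map_neg]
        rw [map_sub, LinearMap.sub_apply, he, he, he, ← lie_skew a (D b), ← lie_skew b (D a),
          map_neg, map_neg, LinearMap.neg_apply, LinearMap.neg_apply, hinv, hinv, hD, hD, hD]
        linarith }
  obtain ⟨w, hw⟩ : ∃ w, LieDerivation.ad ℝ G w = D' :=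
    LieDerivation.IsKilling.exists_eq_ad D'
  refine ⟨killingForm ℝ G w, fun x y => ?_⟩
  rw [← hD, ← hinv]
  have : D' x = ⁅w, x⁆ := by rw [← hw]; simp
  rw [← this]
  rfl
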